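/- Let U ⊆ ℝ^N be a nonempty open set, Γ a flat formal connection on U, p, q ∈ U, ε > 0, and c_0, c_1 : (a−ε, b+ε) → U two smooth paths with c_0(a) = c_1(a) = p and c_0(b) = c_1(b) = q. Suppose there is a smooth homotopy between them: an open set 𝒪 ⊆ ℝ² containing (a−ε,b+ε) × (−ε,1+ε) and a C^∞ map F : 𝒪 → U with F(s,0) = c_0(s) and F(s,1) = c_1(s) for all s, and F(a,t) = p, F(b,t) = q for all t. Then the parallel transports from p to q with respect to Γ along c_0 and along c_1 coincide: W^{(c_0)}_{ba} = W^{(c_1)}_{ba}. -/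

import Mathlib

open Set Filter MeasureTheory

universe u

/-- Piecewise `C^∞` functions on `[a,b]` with singular set `D`: smooth off `D`,
and all one-sided limits of all iterated derivatives exist at the points of `D`. -/
def PWSm (a b : ℝ) (D : Set ℝ) {E : Type*} [NormedAddCommGroup E] [NormedSpace ℝ E]
    (f : ℝ → E) : Prop :=
  ContDiffOn ℝ (⊤ : ℕ∞) f (Set.Icc a b \ D) ∧
  ∀ r : ℕ, ∀ d ∈ D,
    (∃ L : E, Filter.Tendsto (iteratedDerivWithin r f (Set.Icc a b \ D))
      (nhdsWithin d ((Set.Icc a b \ D) ∩ Set.Iio d)) (nhds L)) ∧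
    (∃ L : E, Filter.Tendsto (iteratedDerivWithin r f (Set.Icc a b \ D))
      (nhdsWithin d ((Set.Icc a b \ D) ∩ Set.Ioi d)) (nhds L))

section

variable {𝒜 : Type u} [Ring 𝒜] [Algebra ℂ 𝒜]

/-- An element of `C^∞_D([a,b],ℂ) ⊗ 𝒜`: a finite sum of piecewise smooth complex
functions tensored with algebra elements. -/
def PWTensor (a b : ℝ) (D : Set ℝ) (g : ℝ → 𝒜) : Prop :=
  ∃ (n : ℕ) (f : Fin n → ℝ → ℂ) (v : Fin n → 𝒜),
    (∀ i, PWSm a b D (f i)) ∧ ∀ s, g s = ∑ i, f i s • v i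

/-- An element of `C^∞_D([a,b],ℂ)^0 ⊗ 𝒜`: as `PWTensor` but with the complex
coefficient functions extending continuously to `[a,b]`. -/
def PWTensor0 (a b : ℝ) (D : Set ℝ) (g : ℝ → 𝒜) : Prop :=
  ∃ (n : ℕ) (f : Fin n → ℝ → ℂ) (v : Fin n → 𝒜),
    (∀ i, PWSm a b D (f i) ∧ ContinuousOn (f i) (Set.Icc a b)) ∧
    ∀ s, g s = ∑ i, f i s • v i

/-- `G` is (on `[a,b]`) the primitive of `g` normalized at `α`, computed via any finite
tensor representation of `g`. -/
def HasPrimitiveOn (a b α : ℝ) (g G : ℝ → 𝒜) : Prop :=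
  ∃ (n : ℕ) (f : Fin n → ℝ → ℂ) (v : Fin n → 𝒜),
    (∀ i, ∀ s ∈ Set.Icc a b, IntervalIntegrable (f i) MeasureTheory.volume α s) ∧
    (∀ s, g s = ∑ i, f i s • v i) ∧
    ∀ s ∈ Set.Icc a b, G s = ∑ i, (∫ t in α..s, f i t) • v i

/-- `ω` is a (continuous, piecewise smooth) solution of the formal linear ODE
`dω/ds = λ Y ω`, `ω(α) = init`, written coefficientwise in `λ` in integral form:
`ω = init + λ I_α(Y ω)`. -/
def IsFundSol (a b α : ℝ) (D : Set ℝ) (Y : ℕ → ℝ → 𝒜) (init : ℕ → 𝒜)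
    (ω : ℕ → ℝ → 𝒜) : Prop :=
  (∀ r, PWTensor0 a b D (ω r)) ∧
  (∀ s ∈ Set.Icc a b, ω 0 s = init 0) ∧
  ∀ r : ℕ, ∃ G : ℝ → 𝒜,
    HasPrimitiveOn a b α (fun t => ∑ u ∈ Finset.range (r + 1), Y u t * ω (r - u) t) G ∧
    ∀ s ∈ Set.Icc a b, ω (r + 1) s = init (r + 1) + G s

end

section

variable {𝒜 : Type u} [Ring 𝒜] [Algebra ℂ 𝒜] {N : ℕ}

/-- The value of `ω` at the point `s`, as a formal power series in `𝒜[[λ]]`. -/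
noncomputable def seriesAt (ω : ℕ → ℝ → 𝒜) (s : ℝ) : PowerSeries 𝒜 :=
  PowerSeries.mk fun r => ω r s

/-- The unit `1 ∈ 𝒜[[λ]]` as a sequence of coefficients. -/
def onePS : ℕ → 𝒜 := fun r => if r = 0 then (1 : 𝒜) else 0

/-- A finite sum of smooth complex functions on `U` tensored with elements of `𝒜`. -/
def ConnTensor (U : Set (Fin N → ℝ)) (g : (Fin N → ℝ) → 𝒜) : Prop :=
  ∃ (n : ℕ) (f : Fin n → (Fin N → ℝ) → ℂ) (v : Fin n → 𝒜),
    (∀ i, ContDiffOn ℝ (⊤ : ℕ∞) (f i) U) ∧ ∀ x, g x = ∑ i, f i x • v i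

/-- A formal connection `Γ` on `U ⊆ ℝ^N`: the components `Γ_i` are elements of
`(C^∞(U,ℂ) ⊗ 𝒜)[[λ]]`. -/
def IsFormalConn (U : Set (Fin N → ℝ)) (Γ : Fin N → ℕ → (Fin N → ℝ) → 𝒜) : Prop :=
  ∀ i r, ConnTensor U (Γ i r)

/-- A continuous piecewise `C^∞` path with singular set `D`. -/
def PWPath (a b : ℝ) (D : Set ℝ) (c : ℝ → Fin N → ℝ) : Prop :=
  ContinuousOn c (Set.Icc a b) ∧ ∀ i, PWSm a b D (fun s => c s i)

/-- `Γ^{(c)} = Σ_i (Γ_i ∘ c) dc_i/ds`, the coefficient of the formal linear ODE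
associated to the connection `Γ` and the path `c`. -/
noncomputable def pathField (Γ : Fin N → ℕ → (Fin N → ℝ) → 𝒜) (c : ℝ → Fin N → ℝ)
    (r : ℕ) (s : ℝ) : 𝒜 :=
  ∑ i, ((deriv (fun t => c t i) s : ℝ) : ℂ) • Γ i r (c s)

end

section

variable {𝒜 : Type u} [Ring 𝒜] [Algebra ℂ 𝒜] {N : ℕ}

/-- `h = ∂g/∂x_j` on `U`, computed through a finite tensor representation of `g`. -/
def PartialOf (U : Set (Fin N → ℝ)) (g : (Fin N → ℝ) → 𝒜) (j : Fin N)
    (h : (Fin N → ℝ) → 𝒜) : Prop :=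
  ∃ (n : ℕ) (f : Fin n → (Fin N → ℝ) → ℂ) (v : Fin n → 𝒜),
    (∀ k, ContDiffOn ℝ (⊤ : ℕ∞) (f k) U) ∧ (∀ x, g x = ∑ k, f k x • v k) ∧
    ∀ x ∈ U, h x = ∑ k, (fderiv ℝ (f k) x (Pi.single j 1)) • v k

/-- Formal flatness of `Γ` on `U`:
`∂Γ_i/∂x_j − ∂Γ_j/∂x_i + λ(Γ_iΓ_j − Γ_jΓ_i) = 0`, coefficientwise in `λ`. -/
def IsFlat (U : Set (Fin N → ℝ)) (Γ : Fin N → ℕ → (Fin N → ℝ) → 𝒜) : Prop :=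
  ∃ dΓ : Fin N → Fin N → ℕ → (Fin N → ℝ) → 𝒜,
    (∀ j i r, PartialOf U (Γ i r) j (dΓ j i r)) ∧
    (∀ i j : Fin N, ∀ x ∈ U, dΓ j i 0 x - dΓ i j 0 x = 0) ∧
    ∀ i j : Fin N, ∀ r : ℕ, ∀ x ∈ U,
      dΓ j i (r + 1) x - dΓ i j (r + 1) x +
        ∑ u ∈ Finset.range (r + 1),
          (Γ i u x * Γ j (r - u) x - Γ j u x * Γ i (r - u) x) = 0

end

section FormalCalculus

variable {𝒜 : Type u} [Ring 𝒜] [Algebra ℂ 𝒜]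

theorem eq_of_forall_dual {x y : 𝒜} (h : ∀ φ : Module.Dual ℂ 𝒜, φ x = φ y) : x = y := by
  rw [← sub_eq_zero, ← Module.forall_dual_apply_eq_zero_iff ℂ]
  intro φ
  rw [map_sub, h φ, sub_self]

variable {E : Type*} [NormedAddCommGroup E] [NormedSpace ℝ E]

/-- On `Q`, the function `g` is an element of `C^∞(Q,ℂ) ⊗ 𝒜`. -/
def SmoothTensorOn (Q : Set E) (g : E → 𝒜) : Prop :=
  ∃ (ι : Type) (_ : Fintype ι) (f : ι → E → ℂ) (v : ι → 𝒜),
    (∀ i, ContDiffOn ℝ (⊤ : ℕ∞) (f i) Q) ∧ ∀ x ∈ Q, g x = ∑ i, f i x • v i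

/-- `G` is the derivative of `g` at `x`, tested against all linear functionals on `𝒜`. -/
def HasWeakFDerivAt (g : E → 𝒜) (G : E → 𝒜) (x : E) : Prop :=
  ∀ φ : Module.Dual ℂ 𝒜, ∃ L : E →L[ℝ] ℂ,
    HasFDerivAt (fun y => φ (g y)) L x ∧ ∀ e, L e = φ (G e)

namespace SmoothTensorOn

variable {Q : Set E} {g h : E → 𝒜}

theorem const (Q : Set E) (c : 𝒜) : SmoothTensorOn Q fun _ => c :=
  ⟨Unit, inferInstance, fun _ _ => 1, fun _ => c, fun _ => contDiffOn_const, by simp⟩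

theorem contDiffOn_dual (hg : SmoothTensorOn Q g) (φ : Module.Dual ℂ 𝒜) :
    ContDiffOn ℝ (⊤ : ℕ∞) (fun x => φ (g x)) Q := by
  obtain ⟨ι, _, f, v, hf, hgf⟩ := hg
  refine (ContDiffOn.sum fun i (_ : i ∈ Finset.univ) =>
    (hf i).mul (contDiffOn_const (c := φ (v i)))).congr fun x hx => ?_
  simp [hgf x hx]

theorem mul (hg : SmoothTensorOn Q g) (hh : SmoothTensorOn Q h) :
    SmoothTensorOn Q fun x => g x * h x := by
  obtain ⟨ι, _, f, v, hf, hgf⟩ := hg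
  obtain ⟨κ, _, f', w, hf', hhf⟩ := hh
  refine ⟨ι × κ, inferInstance, fun p x => f p.1 x * f' p.2 x, fun p => v p.1 * w p.2,
    fun p => (hf p.1).mul (hf' p.2), fun x hx => ?_⟩
  beta_reduce
  rw [hgf x hx, hhf x hx, Finset.sum_mul_sum, Fintype.sum_prod_type]
  simp only [smul_mul_smul_comm]

theorem smul {c : E → ℂ} (hc : ContDiffOn ℝ (⊤ : ℕ∞) c Q) (hg : SmoothTensorOn Q g) :
    SmoothTensorOn Q fun x => c x • g x := by
  obtain ⟨ι, _, f, v, hf, hgf⟩ := hg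
  refine ⟨ι, inferInstance, fun i x => c x * f i x, v, fun i => hc.mul (hf i), fun x hx => ?_⟩
  beta_reduce
  rw [hgf x hx, Finset.smul_sum]
  simp only [smul_smul]

theorem sum {κ : Type} (s : Finset κ) {g : κ → E → 𝒜}
    (hg : ∀ k ∈ s, SmoothTensorOn Q (g k)) : SmoothTensorOn Q fun x => ∑ k ∈ s, g k x := by
  have hg' : ∀ k : s, SmoothTensorOn Q (g k) := fun k => hg k k.2
  choose ι _ f v hf hgf using hg'
  refine ⟨(k : s) × ι k, inferInstance, fun p => f p.1 p.2, fun p => v p.1 p.2,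
    fun p => hf p.1 p.2, fun x hx => ?_⟩
  beta_reduce
  rw [Fintype.sum_sigma, ← Finset.sum_coe_sort]
  exact Finset.sum_congr rfl fun k _ => hgf k x hx

theorem comp {E' : Type*} [NormedAddCommGroup E'] [NormedSpace ℝ E'] {Q' : Set E'}
    {F : E' → E} (hg : SmoothTensorOn Q g) (hF : ContDiffOn ℝ (⊤ : ℕ∞) F Q')
    (hmaps : MapsTo F Q' Q) : SmoothTensorOn Q' fun x => g (F x) := by
  obtain ⟨ι, _, f, v, hf, hgf⟩ := hg
  exact ⟨ι, inferInstance, fun i x => f i (F x), v, fun i => (hf i).comp hF hmaps,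
    fun x hx => hgf _ (hmaps hx)⟩

/-- A smooth tensor can be expanded along finitely many vectors with coefficients computed by
linear functionals. Two tensors admit a common such expansion. -/
theorem exists_common_dual_expansion (hg : SmoothTensorOn Q g) (hh : SmoothTensorOn Q h) :
    ∃ (n : ℕ) (φ : Fin n → Module.Dual ℂ 𝒜) (v : Fin n → 𝒜),
      ∀ x ∈ Q, g x = ∑ i, φ i (g x) • v i ∧ h x = ∑ i, φ i (h x) • v i := by
  obtain ⟨ι, _, f, v, -, hgf⟩ := hg
  obtain ⟨κ, _, f', w, -, hhf⟩ := hh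
  let S : Submodule ℂ 𝒜 := Submodule.span ℂ (range v ∪ range w)
  have : FiniteDimensional ℂ S :=
    FiniteDimensional.span_of_finite ℂ ((finite_range v).union (finite_range w))
  let B := Module.finBasis ℂ S
  choose φ hφ using fun i => LinearMap.exists_extend (B.coord i)
  have key : ∀ y ∈ S, y = ∑ i, φ i y • (B i : 𝒜) := by
    intro y hy
    have h1 : ∀ i, φ i y = B.coord i ⟨y, hy⟩ := fun i => LinearMap.congr_fun (hφ i) ⟨y, hy⟩
    simp only [h1]
    simpa only [map_sum, map_smul, Submodule.subtype_apply, Module.Basis.coord_apply] using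
      (congrArg S.subtype (B.sum_repr ⟨y, hy⟩)).symm
  refine ⟨_, φ, fun i => (B i : 𝒜), fun x hx => ⟨key _ ?_, key _ ?_⟩⟩
  · rw [hgf x hx]
    exact Submodule.sum_mem _ fun i _ => S.smul_mem _
      (Submodule.subset_span (Or.inl (mem_range_self i)))
  · rw [hhf x hx]
    exact Submodule.sum_mem _ fun i _ => S.smul_mem _
      (Submodule.subset_span (Or.inr (mem_range_self i)))

end SmoothTensorOn

namespace HasWeakFDerivAt

variable {g h : E → 𝒜} {G H : E → 𝒜} {x : E}

theorem const (c : 𝒜) (x : E) : HasWeakFDerivAt (fun _ => c) (fun _ => 0) x :=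
  fun φ => ⟨0, hasFDerivAt_const _ _, by simp⟩

theorem sum {κ : Type*} (s : Finset κ) {g G : κ → E → 𝒜}
    (hg : ∀ k ∈ s, HasWeakFDerivAt (g k) (G k) x) :
    HasWeakFDerivAt (fun y => ∑ k ∈ s, g k y) (fun e => ∑ k ∈ s, G k e) x := by
  intro φ
  have hg' : ∀ k : s, _ := fun k => hg k k.2 φ
  choose L hL hLG using hg'
  refine ⟨∑ k : s, L k, ?_, fun e => ?_⟩
  · have := HasFDerivAt.fun_sum (u := Finset.univ) fun k _ => hL k
    simpa only [map_sum, ← Finset.sum_coe_sort s] using this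
  · simp only [_root_.sum_apply, hLG, map_sum, ← Finset.sum_coe_sort s]

theorem smul {c : E → ℂ} {c' : E →L[ℝ] ℂ} (hc : HasFDerivAt c c' x)
    (hg : HasWeakFDerivAt g G x) :
    HasWeakFDerivAt (fun y => c y • g y) (fun e => c' e • g x + c x • G e) x := by
  intro φ
  obtain ⟨L, hL, hLG⟩ := hg φ
  refine ⟨_, (hc.mul hL).congr_of_eventuallyEq (by simp [Filter.EventuallyEq]), fun e => ?_⟩
  simp [hLG]
  ring

theorem mul {Q : Set E} (hQ : IsOpen Q) (hx : x ∈ Q) (hgQ : SmoothTensorOn Q g)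
    (hhQ : SmoothTensorOn Q h) (hg : HasWeakFDerivAt g G x) (hh : HasWeakFDerivAt h H x) :
    HasWeakFDerivAt (fun y => g y * h y) (fun e => G e * h x + g x * H e) x := by
  have hnhds := hQ.mem_nhds hx
  have expand : ∀ {k K : E → 𝒜} {ι : Type} [Fintype ι] {f : ι → E → ℂ} {v : ι → 𝒜},
      (∀ i, ContDiffOn ℝ (⊤ : ℕ∞) (f i) Q) → (∀ y ∈ Q, k y = ∑ i, f i y • v i) →
      HasWeakFDerivAt k K x → ∀ e, K e = ∑ i, fderiv ℝ (f i) x e • v i := by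
    intro k K ι _ f v hf hkf hk e
    refine eq_of_forall_dual fun φ => ?_
    obtain ⟨L, hL, hLK⟩ := hk φ
    have h1 : HasFDerivAt (fun y => φ (k y)) (∑ i, (φ (v i)) • fderiv ℝ (f i) x) x := by
      refine (HasFDerivAt.fun_sum (u := Finset.univ) fun i _ =>
        ((((hf i).contDiffAt hnhds).differentiableAt (by simp)).hasFDerivAt.const_mul
          (φ (v i)))).congr_of_eventuallyEq ?_
      filter_upwards [hnhds] with y hy
      simp [hkf y hy, mul_comm]
    rw [← hLK, hL.unique h1]
    simp [mul_comm]
  obtain ⟨ι, _, f, v, hf, hgf⟩ := hgQ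
  obtain ⟨κ, _, f', w, hf', hhf⟩ := hhQ
  intro φ
  have d1 : ∀ i, HasFDerivAt (f i) (fderiv ℝ (f i) x) x := fun i =>
    (((hf i).contDiffAt hnhds).differentiableAt (by simp)).hasFDerivAt
  have d2 : ∀ i, HasFDerivAt (f' i) (fderiv ℝ (f' i) x) x := fun i =>
    (((hf' i).contDiffAt hnhds).differentiableAt (by simp)).hasFDerivAt
  refine ⟨_, (HasFDerivAt.fun_sum (u := Finset.univ) fun i _ =>
    HasFDerivAt.fun_sum (u := Finset.univ) fun j _ =>
      ((d1 i).mul (d2 j)).mul_const (φ (v i * w j))).congr_of_eventuallyEq ?_, fun e => ?_⟩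
  · filter_upwards [hnhds] with y hy
    rw [hgf y hy, hhf y hy, Finset.sum_mul_sum]
    simp only [smul_mul_smul_comm, map_sum, map_smul, smul_eq_mul, Pi.mul_apply]
  · beta_reduce
    rw [expand hf hgf hg, expand hf' hhf hh, hgf x hx, hhf x hx, Finset.sum_mul_sum,
      Finset.sum_mul_sum, ← Finset.sum_add_distrib, map_sum, _root_.sum_apply]
    refine Finset.sum_congr rfl fun i _ => ?_
    rw [← Finset.sum_add_distrib, map_sum, _root_.sum_apply]
    refine Finset.sum_congr rfl fun j _ => ?_
    simp
    ring

end HasWeakFDerivAt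

/-- Poincaré lemma for a closed `𝒜`-valued one-form `g ds + h dt` on a convex planar domain. -/
theorem SmoothTensorOn.exists_primitive {Q : Set (ℝ × ℝ)} (hQ : IsOpen Q) (hconv : Convex ℝ Q)
    {g h : ℝ × ℝ → 𝒜} (hg : SmoothTensorOn Q g) (hh : SmoothTensorOn Q h)
    {G H : ℝ × ℝ → ℝ × ℝ → 𝒜} (hG : ∀ x ∈ Q, HasWeakFDerivAt g (G x) x)
    (hH : ∀ x ∈ Q, HasWeakFDerivAt h (H x) x) (hclosed : ∀ x ∈ Q, G x (0, 1) = H x (1, 0))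
    (x₀ : ℝ × ℝ) :
    ∃ Ψ : ℝ × ℝ → 𝒜, SmoothTensorOn Q Ψ ∧ Ψ x₀ = 0 ∧
      ∀ x ∈ Q, HasWeakFDerivAt Ψ (fun e => (e.1 : ℂ) • g x + (e.2 : ℂ) • h x) x := by
  obtain ⟨n, φ, v, hexp⟩ := hg.exists_common_dual_expansion hh
  let ω : Fin n → ℝ × ℝ → (ℝ × ℝ →L[ℝ] ℂ) := fun i x =>
    (ContinuousLinearMap.fst ℝ ℝ ℝ).smulRight (φ i (g x)) +
      (ContinuousLinearMap.snd ℝ ℝ ℝ).smulRight (φ i (h x))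
  have hω : ∀ i, ContDiffOn ℝ (⊤ : ℕ∞) (ω i) Q := fun i =>
    (contDiffOn_const.smulRight (hg.contDiffOn_dual (φ i))).add
      (contDiffOn_const.smulRight (hh.contDiffOn_dual (φ i)))
  have hprim : ∀ i, ∃ f : ℝ × ℝ → ℂ, ∀ x ∈ Q, HasFDerivAt f (ω i x) x := by
    intro i
    refine hconv.exists_forall_hasFDerivAt_of_fderiv_symmetric hQ
      ((hω i).differentiableOn (by simp)) fun x hx y z => ?_
    obtain ⟨L, hL, hLG⟩ := hG x hx (φ i)
    obtain ⟨M, hM, hMH⟩ := hH x hx (φ i)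
    have hd : HasFDerivAt (ω i) _ x :=
      (((ContinuousLinearMap.smulRightL ℝ (ℝ × ℝ) ℂ
        (ContinuousLinearMap.fst ℝ ℝ ℝ)).hasFDerivAt).comp x hL).add
      (((ContinuousLinearMap.smulRightL ℝ (ℝ × ℝ) ℂ
        (ContinuousLinearMap.snd ℝ ℝ ℝ)).hasFDerivAt).comp x hM)
    have hLM : L (0, 1) = M (1, 0) := by rw [hLG, hMH, hclosed x hx]
    have split : ∀ (T : ℝ × ℝ →L[ℝ] ℂ) (y : ℝ × ℝ),
        T y = y.1 * T (1, 0) + y.2 * T (0, 1) := by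
      intro T y
      conv_lhs => rw [show y = y.1 • ((1 : ℝ), (0 : ℝ)) + y.2 • ((0 : ℝ), (1 : ℝ)) by
        ext <;> simp]
      simp only [map_add, map_smul, Complex.real_smul]
    rw [hd.fderiv]
    simp only [_root_.add_apply, ContinuousLinearMap.comp_apply,
      ContinuousLinearMap.smulRightL_apply_apply, ContinuousLinearMap.coe_fst',
      ContinuousLinearMap.coe_snd', ContinuousLinearMap.smulRight_apply, Complex.real_smul]
    rw [split L y, split L z, split M y, split M z, hLM]
    ring
  choose f hf using hprim
  have hfsm : ∀ i, ContDiffOn ℝ (⊤ : ℕ∞) (f i) Q := fun i =>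
    (contDiffOn_infty_iff_fderiv_of_isOpen hQ).2
      ⟨fun x hx => (hf i x hx).differentiableAt.differentiableWithinAt,
        (hω i).congr fun x hx => (hf i x hx).fderiv⟩
  refine ⟨fun x => ∑ i, (f i x - f i x₀) • v i, ⟨Fin n, inferInstance, _, v,
    fun i => (hfsm i).sub contDiffOn_const, fun _ _ => rfl⟩, by simp, fun x hx ψ => ?_⟩
  refine ⟨_, (HasFDerivAt.fun_sum (u := Finset.univ) fun i _ =>
    ((hf i x hx).sub_const (f i x₀)).mul_const (ψ (v i))).congr_of_eventuallyEq ?_, fun e => ?_⟩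
  · exact Filter.Eventually.of_forall fun y => by simp
  · conv_rhs => rw [(hexp x hx).1, (hexp x hx).2]
    simp only [ω, _root_.sum_apply, _root_.smul_apply,
      _root_.add_apply, ContinuousLinearMap.smulRight_apply,
      ContinuousLinearMap.coe_fst', ContinuousLinearMap.coe_snd', Complex.real_smul, map_add,
      map_sum, map_smul, smul_eq_mul, Finset.mul_sum, ← Finset.sum_add_distrib]
    exact Finset.sum_congr rfl fun i _ => by ring

theorem PowerSeries.coeff_mk_mul_mk {R : Type*} [Semiring R] (p q : ℕ → R) (k : ℕ) :
    PowerSeries.coeff k (PowerSeries.mk p * PowerSeries.mk q) =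
      ∑ u ∈ Finset.range (k + 1), p u * q (k - u) := by
  rw [PowerSeries.coeff_mul]
  simp only [PowerSeries.coeff_mk]
  exact Finset.Nat.sum_antidiagonal_eq_sum_range_succ (fun i j => p i * q j) k

/-- Cross derivatives of `Φ` agree to order `n` if `dΦ = λ (a ds + b dt) Φ` to that order and
`a ds + b dt` has zero curvature. -/
theorem coeff_cross_deriv_eq {R : Type*} [Ring R] {a b a' b' w ws wt : PowerSeries R} {n : ℕ}
    (hcurv : a' - b' + PowerSeries.X * (a * b - b * a) = 0)
    (hs : ∀ k ≤ n, PowerSeries.coeff k ws = PowerSeries.coeff k (PowerSeries.X * (a * w)))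
    (ht : ∀ k ≤ n, PowerSeries.coeff k wt = PowerSeries.coeff k (PowerSeries.X * (b * w))) :
    PowerSeries.coeff n (a' * w + a * wt) = PowerSeries.coeff n (b' * w + b * ws) := by
  have left_congr : ∀ {c y z : PowerSeries R},
      (∀ k ≤ n, PowerSeries.coeff k y = PowerSeries.coeff k z) →
      PowerSeries.coeff n (c * y) = PowerSeries.coeff n (c * z) := by
    intro c y z h
    rw [PowerSeries.coeff_mul, PowerSeries.coeff_mul]
    exact Finset.sum_congr rfl fun p hp => by
      rw [h _ (by
        have := Finset.HasAntidiagonal.mem_antidiagonal.1 hp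
        omega)]
  rw [map_add, map_add, left_congr hs, left_congr ht, ← map_add, ← map_add, ← sub_eq_zero,
    ← map_sub]
  have hX : ∀ c d : PowerSeries R,
      c * (PowerSeries.X * d) = PowerSeries.X * (c * d) := fun c d => by
    rw [← mul_assoc, ← (PowerSeries.commute_X c).eq.symm, mul_assoc]
  have : a' * w + a * (PowerSeries.X * (b * w)) - (b' * w + b * (PowerSeries.X * (a * w))) =
      (a' - b' + PowerSeries.X * (a * b - b * a)) * w := by
    rw [hX, hX]
    noncomm_ring
  rw [this, hcurv, zero_mul, map_zero]

/-- A planar formal connection `A ds + B dt` of zero curvature on a convex domain admits, to any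
finite order in `λ`, a solution of `dΦ = λ (A ds + B dt) Φ` normalized at `x₀`. -/
theorem exists_flat_section {Q : Set (ℝ × ℝ)} (hQ : IsOpen Q) (hconv : Convex ℝ Q)
    {A B : ℕ → ℝ × ℝ → 𝒜} (hA : ∀ r, SmoothTensorOn Q (A r)) (hB : ∀ r, SmoothTensorOn Q (B r))
    {A' B' : ℕ → ℝ × ℝ → ℝ × ℝ → 𝒜}
    (hA' : ∀ r, ∀ x ∈ Q, HasWeakFDerivAt (A r) (A' r x) x)
    (hB' : ∀ r, ∀ x ∈ Q, HasWeakFDerivAt (B r) (B' r x) x)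
    (hcurv : ∀ x ∈ Q, PowerSeries.mk (fun r => A' r x (0, 1)) -
      PowerSeries.mk (fun r => B' r x (1, 0)) + PowerSeries.X *
        (PowerSeries.mk (fun r => A r x) * PowerSeries.mk (fun r => B r x) -
          PowerSeries.mk (fun r => B r x) * PowerSeries.mk (fun r => A r x)) = 0)
    (x₀ : ℝ × ℝ) (n : ℕ) :
    ∃ Φ : ℕ → ℝ × ℝ → 𝒜, (∀ k ≤ n, SmoothTensorOn Q (Φ k)) ∧ (∀ x, Φ 0 x = 1) ∧
      ∀ k < n, Φ (k + 1) x₀ = 0 ∧ ∀ x ∈ Q, HasWeakFDerivAt (Φ (k + 1))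
        (fun e => (e.1 : ℂ) • ∑ u ∈ Finset.range (k + 1), A u x * Φ (k - u) x +
          (e.2 : ℂ) • ∑ u ∈ Finset.range (k + 1), B u x * Φ (k - u) x) x := by
  induction n with
  | zero =>
    refine ⟨fun _ _ => 1, fun _ _ => SmoothTensorOn.const Q 1, fun _ => rfl, fun k hk => ?_⟩
    exact absurd hk k.not_lt_zero
  | succ n ih =>
    obtain ⟨Φ, hΦ, hΦ0, hΦd⟩ := ih
    let S : (ℕ → ℝ × ℝ → 𝒜) → ℝ × ℝ → PowerSeries 𝒜 := fun C x => PowerSeries.mk fun r => C r x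
    let Φ' : ℕ → ℝ × ℝ → ℝ × ℝ → 𝒜 := fun k x e =>
      (e.1 : ℂ) • PowerSeries.coeff k (PowerSeries.X * (S A x * S Φ x)) +
        (e.2 : ℂ) • PowerSeries.coeff k (PowerSeries.X * (S B x * S Φ x))
    have hΦ' : ∀ k ≤ n, ∀ x ∈ Q, HasWeakFDerivAt (Φ k) (Φ' k x) x := by
      intro k hk x hx
      rcases k with _ | k
      · have : Φ 0 = fun _ => 1 := funext hΦ0
        rw [this]
        convert HasWeakFDerivAt.const (1 : 𝒜) x using 1
        funext e
        simp [Φ']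
      · convert (hΦd k hk).2 x hx using 1
        funext e
        simp only [Φ', S, PowerSeries.coeff_succ_X_mul, PowerSeries.coeff_mk_mul_mk]
    have conv_smooth : ∀ C : ℕ → ℝ × ℝ → 𝒜, (∀ r, SmoothTensorOn Q (C r)) →
        SmoothTensorOn Q fun x => ∑ u ∈ Finset.range (n + 1), C u x * Φ (n - u) x :=
      fun C hC => SmoothTensorOn.sum _ fun u _ => (hC u).mul (hΦ _ (n.sub_le u))
    have conv_deriv : ∀ (C : ℕ → ℝ × ℝ → 𝒜) (C' : ℕ → ℝ × ℝ → ℝ × ℝ → 𝒜),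
        (∀ r, SmoothTensorOn Q (C r)) → (∀ r, ∀ x ∈ Q, HasWeakFDerivAt (C r) (C' r x) x) →
        ∀ x ∈ Q, HasWeakFDerivAt (fun x => ∑ u ∈ Finset.range (n + 1), C u x * Φ (n - u) x)
          (fun e => PowerSeries.coeff n (PowerSeries.mk (fun r => C' r x e) * S Φ x +
            S C x * PowerSeries.mk fun r => Φ' r x e)) x := by
      intro C C' hC hC' x hx
      convert HasWeakFDerivAt.sum (Finset.range (n + 1)) (g := fun u x => C u x * Φ (n - u) x)
        (G := fun u e => C' u x e * Φ (n - u) x + C u x * Φ' (n - u) x e) fun u _ =>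
        (hC' u x hx).mul hQ hx (hC u) (hΦ _ (n.sub_le u)) (hΦ' _ (n.sub_le u) x hx) using 1
      funext e
      rw [map_add, PowerSeries.coeff_mk_mul_mk, PowerSeries.coeff_mk_mul_mk, Finset.sum_add_distrib]
    obtain ⟨Ψ, hΨ, hΨ0, hΨd⟩ := SmoothTensorOn.exists_primitive hQ hconv (conv_smooth A hA)
      (conv_smooth B hB) (conv_deriv A A' hA hA') (conv_deriv B B' hB hB')
      (fun x hx => coeff_cross_deriv_eq (hcurv x hx) (by simp [Φ', S]) (by simp [Φ', S])) x₀
    refine ⟨Function.update Φ (n + 1) Ψ, fun k hk => ?_, fun x => ?_, fun k hk => ?_⟩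
    · rcases hk.lt_or_eq with hk | rfl
      · rw [Function.update_of_ne hk.ne]
        exact hΦ k (by omega)
      · rwa [Function.update_self]
    · rw [Function.update_of_ne (by omega), hΦ0]
    · have hlow : ∀ u, Function.update Φ (n + 1) Ψ (k - u) = Φ (k - u) := fun u =>
        Function.update_of_ne (by omega) _ _
      simp only [hlow]
      rcases (Nat.lt_succ_iff.1 hk).lt_or_eq with hk | rfl
      · rw [Function.update_of_ne (by omega)]
        exact hΦd k hk
      · rw [Function.update_self]
        exact ⟨hΨ0, hΨd⟩

/-- A solution of the integral equation agrees with a (weakly) differentiable solution of the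
differential equation having the same initial value. -/
theorem IsFundSol.eq_of_hasDerivAt {a b : ℝ} {D : Set ℝ} {Y : ℕ → ℝ → 𝒜} {W : ℕ → ℝ → 𝒜}
    (hW : IsFundSol a b a D Y onePS W) {Φ : ℕ → ℝ → 𝒜} {n : ℕ}
    (h0 : ∀ s ∈ Icc a b, Φ 0 s = 1) (ha : ∀ k < n, Φ (k + 1) a = 0)
    (hd : ∀ k < n, ∀ s ∈ Icc a b, ∀ φ : Module.Dual ℂ 𝒜, HasDerivAt (fun t => φ (Φ (k + 1) t))
      (φ (∑ u ∈ Finset.range (k + 1), Y u s * Φ (k - u) s)) s) :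
    ∀ k ≤ n, ∀ s ∈ Icc a b, W k s = Φ k s := by
  intro k
  induction k using Nat.strong_induction_on with
  | _ k ih =>
    intro hk s hs
    rcases k with _ | k
    · rw [hW.2.1 s hs, h0 s hs]
      simp [onePS]
    · obtain ⟨G, ⟨m, f, v, hint, hf, hG⟩, hWG⟩ := hW.2.2 k
      refine eq_of_forall_dual fun φ => ?_
      have hsub : uIcc a s ⊆ Icc a b := by
        rw [uIcc_of_le hs.1]
        exact Icc_subset_Icc_right hs.2
      have hval : ∀ t ∈ uIcc a s, ∑ i, f i t * φ (v i) =
          φ (∑ u ∈ Finset.range (k + 1), Y u t * Φ (k - u) t) := by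
        intro t ht
        have h1 : ∑ u ∈ Finset.range (k + 1), Y u t * Φ (k - u) t =
            ∑ u ∈ Finset.range (k + 1), Y u t * W (k - u) t :=
          Finset.sum_congr rfl fun u _ => by
            rw [ih (k - u) (by omega) (by omega) t (hsub ht)]
        have h2 := hf t
        beta_reduce at h2
        rw [h1, h2]
        simp
      have hii : ∀ i ∈ (Finset.univ : Finset (Fin m)),
          IntervalIntegrable (fun t => f i t * φ (v i)) volume a s :=
        fun i _ => (hint i s hs).mul_const _
      have hftc := intervalIntegral.integral_eq_sub_of_hasDerivAt
        (f := fun t => φ (Φ (k + 1) t)) (f' := fun t => ∑ i, f i t * φ (v i)) (a := a) (b := s)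
        (fun t ht => by
          rw [hval t ht]
          exact hd k (by omega) t (hsub ht) φ)
        (by simpa only [Finset.sum_fn] using IntervalIntegrable.sum Finset.univ hii)
      rw [intervalIntegral.integral_finsetSum hii, ha k (by omega), map_zero, sub_zero] at hftc
      rw [hWG s hs, hG s hs, ← hftc]
      simp [onePS]

/-- The component along `e` of the pullback of the one-form `Σ_i Γ_i dx_i` by `F`. -/
noncomputable def pullbackField {N : ℕ} (Γ : Fin N → ℕ → (Fin N → ℝ) → 𝒜) (F : E → Fin N → ℝ)
    (e : E) (r : ℕ) (x : E) : 𝒜 :=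
  ∑ i, ((fderiv ℝ F x e i : ℝ) : ℂ) • Γ i r (F x)

section Pullback

variable {N : ℕ} {U : Set (Fin N → ℝ)} {Γ : Fin N → ℕ → (Fin N → ℝ) → 𝒜}
  {F : E → Fin N → ℝ} {Q : Set E} {x : E}

theorem IsFormalConn.smoothTensorOn (hΓ : IsFormalConn U Γ) (i : Fin N) (r : ℕ) :
    SmoothTensorOn U (Γ i r) := by
  obtain ⟨n, f, v, hf, hΓf⟩ := hΓ i r
  exact ⟨Fin n, inferInstance, f, v, hf, fun x _ => hΓf x⟩

theorem IsFormalConn.smoothTensorOn_pullbackField (hΓ : IsFormalConn U Γ) (hQ : IsOpen Q)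
    (hF : ContDiffOn ℝ (⊤ : ℕ∞) F Q) (hFU : MapsTo F Q U) (e : E) (r : ℕ) :
    SmoothTensorOn Q (pullbackField Γ F e r) := by
  refine SmoothTensorOn.sum _ fun i _ => SmoothTensorOn.smul ?_
    ((hΓ.smoothTensorOn i r).comp hF hFU)
  have h1 : ContDiffOn ℝ (⊤ : ℕ∞) (fun x => fderiv ℝ F x e) Q :=
    (hF.fderiv_of_isOpen hQ (by simp)).clm_apply contDiffOn_const
  exact Complex.ofRealCLM.contDiff.comp_contDiffOn (contDiffOn_pi.1 h1 i)

/-- Chain rule for a smooth tensor whose partial derivatives are known. -/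
theorem SmoothTensorOn.hasWeakFDerivAt_comp {g : (Fin N → ℝ) → 𝒜}
    {g' : Fin N → (Fin N → ℝ) → 𝒜} (hU : IsOpen U) (hg : SmoothTensorOn U g)
    (hg' : ∀ j, PartialOf U g j (g' j)) (hF : DifferentiableAt ℝ F x) (hx : F x ∈ U) :
    HasWeakFDerivAt (fun y => g (F y))
      (fun e => ∑ j, ((fderiv ℝ F x e j : ℝ) : ℂ) • g' j (F x)) x := by
  intro φ
  have hnhds := hU.mem_nhds hx
  have hd : DifferentiableAt ℝ (fun y => φ (g y)) (F x) :=
    ((hg.contDiffOn_dual φ).contDiffAt hnhds).differentiableAt (by simp)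
  refine ⟨_, hd.hasFDerivAt.comp x hF.hasFDerivAt, fun e => ?_⟩
  have hpartial : ∀ j, fderiv ℝ (fun y => φ (g y)) (F x) (Pi.single j 1) = φ (g' j (F x)) := by
    intro j
    obtain ⟨n, f, v, hf, hgf, hg'f⟩ := hg' j
    have h1 : HasFDerivAt (fun y => φ (g y)) (∑ i, φ (v i) • fderiv ℝ (f i) (F x)) (F x) := by
      refine (HasFDerivAt.fun_sum (u := Finset.univ) fun i _ =>
        (((hf i).contDiffAt hnhds).differentiableAt (by simp)).hasFDerivAt.const_mul
          (φ (v i))).congr_of_eventuallyEq (Filter.Eventually.of_forall fun y => ?_)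
      simp [hgf y, mul_comm]
    rw [h1.fderiv, hg'f _ hx]
    simp [mul_comm]
  rw [ContinuousLinearMap.comp_apply, ← ContinuousLinearMap.coe_coe,
    LinearMap.pi_apply_eq_sum_univ]
  simp only [map_sum, map_smul, smul_eq_mul, ← hpartial, Complex.real_smul,
    ContinuousLinearMap.coe_coe]
  refine Finset.sum_congr rfl fun j _ => ?_
  congr 3
  funext i
  simp [Pi.single_apply, eq_comm]

/-- The derivative along `e'` of `pullbackField Γ F e r`, where `dΓ j i r = ∂Γ_i/∂x_j`. -/
noncomputable def pullbackFieldDeriv (Γ : Fin N → ℕ → (Fin N → ℝ) → 𝒜)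
    (dΓ : Fin N → Fin N → ℕ → (Fin N → ℝ) → 𝒜) (F : E → Fin N → ℝ)
    (e : E) (r : ℕ) (x e' : E) : 𝒜 :=
  ∑ i, (((fderiv ℝ (fderiv ℝ F) x e' e i : ℝ) : ℂ) • Γ i r (F x) +
    ((fderiv ℝ F x e i : ℝ) : ℂ) • ∑ j, ((fderiv ℝ F x e' j : ℝ) : ℂ) • dΓ j i r (F x))

theorem IsFormalConn.hasWeakFDerivAt_pullbackField {dΓ : Fin N → Fin N → ℕ → (Fin N → ℝ) → 𝒜}
    (hΓ : IsFormalConn U Γ) (hdΓ : ∀ j i r, PartialOf U (Γ i r) j (dΓ j i r)) (hU : IsOpen U)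
    (hF : ContDiffAt ℝ (⊤ : ℕ∞) F x) (hx : F x ∈ U) (e : E) (r : ℕ) :
    HasWeakFDerivAt (pullbackField Γ F e r) (pullbackFieldDeriv Γ dΓ F e r x) x := by
  refine HasWeakFDerivAt.sum _ fun i _ => ?_
  have h2 : HasFDerivAt (fderiv ℝ F) (fderiv ℝ (fderiv ℝ F) x) x :=
    ((hF.fderiv_right (m := 1) (by norm_cast)).differentiableAt (by simp)).hasFDerivAt
  let T : (E →L[ℝ] Fin N → ℝ) →L[ℝ] ℂ := Complex.ofRealCLM.comp
    ((ContinuousLinearMap.proj i).comp (ContinuousLinearMap.apply ℝ (Fin N → ℝ) e))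
  exact HasWeakFDerivAt.smul (c := fun y => ((fderiv ℝ F y e i : ℝ) : ℂ))
    (T.hasFDerivAt.comp x h2)
    ((hΓ.smoothTensorOn i r).hasWeakFDerivAt_comp hU (fun j => hdΓ j i r)
      (hF.differentiableAt (by simp)) hx)

theorem pullbackField_mul (e e' : E) (u v : ℕ) :
    pullbackField Γ F e u x * pullbackField Γ F e' v x =
      ∑ i, ∑ j, (((fderiv ℝ F x e i : ℝ) : ℂ) * ((fderiv ℝ F x e' j : ℝ) : ℂ)) •
        (Γ i u (F x) * Γ j v (F x)) := by
  simp only [pullbackField, Finset.sum_mul_sum, smul_mul_smul_comm]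

theorem pullbackFieldDeriv_sub {dΓ : Fin N → Fin N → ℕ → (Fin N → ℝ) → 𝒜}
    (hF : ContDiffAt ℝ (⊤ : ℕ∞) F x) (e e' : E) (r : ℕ) :
    pullbackFieldDeriv Γ dΓ F e r x e' - pullbackFieldDeriv Γ dΓ F e' r x e =
      ∑ i, ∑ j, (((fderiv ℝ F x e i : ℝ) : ℂ) * ((fderiv ℝ F x e' j : ℝ) : ℂ)) •
        (dΓ j i r (F x) - dΓ i j r (F x)) := by
  have hsymm : fderiv ℝ (fderiv ℝ F) x e' e = fderiv ℝ (fderiv ℝ F) x e e' :=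
    hF.isSymmSndFDerivAt (by
      rw [minSmoothness_of_isRCLikeNormedField]
      exact WithTop.coe_le_coe.2 (le_top (a := (2 : ℕ∞)))) e' e
  simp only [pullbackFieldDeriv, hsymm, Finset.sum_add_distrib, add_sub_add_left_eq_sub,
    Finset.smul_sum, smul_smul, smul_sub, Finset.sum_sub_distrib]
  congr 1
  rw [Finset.sum_comm]
  simp only [mul_comm]

/-- The pullback of a flat connection has zero curvature. -/
theorem pullbackField_curvature {dΓ : Fin N → Fin N → ℕ → (Fin N → ℝ) → 𝒜}
    (hflat₀ : ∀ i j : Fin N, ∀ x ∈ U, dΓ j i 0 x - dΓ i j 0 x = 0)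
    (hflat : ∀ i j : Fin N, ∀ r : ℕ, ∀ x ∈ U, dΓ j i (r + 1) x - dΓ i j (r + 1) x +
      ∑ u ∈ Finset.range (r + 1),
        (Γ i u x * Γ j (r - u) x - Γ j u x * Γ i (r - u) x) = 0)
    (hF : ContDiffAt ℝ (⊤ : ℕ∞) F x) (hx : F x ∈ U) (e e' : E) :
    PowerSeries.mk (fun r => pullbackFieldDeriv Γ dΓ F e r x e') -
      PowerSeries.mk (fun r => pullbackFieldDeriv Γ dΓ F e' r x e) + PowerSeries.X *
        (PowerSeries.mk (fun r => pullbackField Γ F e r x) *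
            PowerSeries.mk (fun r => pullbackField Γ F e' r x) -
          PowerSeries.mk (fun r => pullbackField Γ F e' r x) *
            PowerSeries.mk (fun r => pullbackField Γ F e r x)) = 0 := by
  ext r
  rcases r with _ | r
  · simp [pullbackFieldDeriv_sub hF, hflat₀ _ _ _ hx]
  · rw [map_add, map_sub, PowerSeries.coeff_succ_X_mul, map_sub, PowerSeries.coeff_mk,
      PowerSeries.coeff_mk, pullbackFieldDeriv_sub hF, PowerSeries.coeff_mk_mul_mk,
      PowerSeries.coeff_mk_mul_mk, map_zero, ← Finset.sum_sub_distrib]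
    have hcomm : ∀ u, pullbackField Γ F e u x * pullbackField Γ F e' (r - u) x -
        pullbackField Γ F e' u x * pullbackField Γ F e (r - u) x =
        ∑ i, ∑ j, (((fderiv ℝ F x e i : ℝ) : ℂ) * ((fderiv ℝ F x e' j : ℝ) : ℂ)) •
          (Γ i u (F x) * Γ j (r - u) (F x) - Γ j u (F x) * Γ i (r - u) (F x)) := by
      intro u
      rw [pullbackField_mul, pullbackField_mul]
      simp only [smul_sub, Finset.sum_sub_distrib]
      congr 1
      rw [Finset.sum_comm]
      simp only [mul_comm]
    simp only [hcomm]
    rw [Finset.sum_comm (s := Finset.range (r + 1)), ← Finset.sum_add_distrib]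
    refine Finset.sum_eq_zero fun i _ => ?_
    rw [Finset.sum_comm (s := Finset.range (r + 1)), ← Finset.sum_add_distrib]
    refine Finset.sum_eq_zero fun j _ => ?_
    rw [← Finset.smul_sum, ← smul_add, hflat i j r _ hx, smul_zero]

end Pullback

end FormalCalculus

/-- For a flat formal connection, the parallel transports from `p`
to `q` along two smoothly homotopic (with fixed endpoints) smooth paths coincide. -/
theorem statement12 {𝒜 : Type u} [Ring 𝒜] [Algebra ℂ 𝒜] {N : ℕ}
    (U : Set (Fin N → ℝ)) (hUopen : IsOpen U) (hUne : U.Nonempty)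
    (Γ : Fin N → ℕ → (Fin N → ℝ) → 𝒜) (hΓ : IsFormalConn U Γ) (hflat : IsFlat U Γ)
    (p q : Fin N → ℝ) (hp : p ∈ U) (hq : q ∈ U)
    (a b : ℝ) (hab : a < b) (ε : ℝ) (hε : 0 < ε)
    (c₀ c₁ : ℝ → Fin N → ℝ)
    (hc₀ : ContDiffOn ℝ (⊤ : ℕ∞) c₀ (Set.Ioo (a - ε) (b + ε)))
    (hc₁ : ContDiffOn ℝ (⊤ : ℕ∞) c₁ (Set.Ioo (a - ε) (b + ε)))
    (hc₀U : Set.MapsTo c₀ (Set.Ioo (a - ε) (b + ε)) U)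
    (hc₁U : Set.MapsTo c₁ (Set.Ioo (a - ε) (b + ε)) U)
    (hc₀a : c₀ a = p) (hc₁a : c₁ a = p) (hc₀b : c₀ b = q) (hc₁b : c₁ b = q)
    (𝒪 : Set (ℝ × ℝ)) (h𝒪open : IsOpen 𝒪)
    (h𝒪sub : Set.Ioo (a - ε) (b + ε) ×ˢ Set.Ioo (-ε) (1 + ε) ⊆ 𝒪)
    (F : ℝ × ℝ → Fin N → ℝ) (hF : ContDiffOn ℝ (⊤ : ℕ∞) F 𝒪) (hFU : Set.MapsTo F 𝒪 U)
    (hF0 : ∀ s ∈ Set.Ioo (a - ε) (b + ε), F (s, 0) = c₀ s ∧ F (s, 1) = c₁ s)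
    (hFa : ∀ t ∈ Set.Ioo (-ε) (1 + ε), F (a, t) = p ∧ F (b, t) = q)
    (W₀ W₁ : ℕ → ℝ → 𝒜)
    (hW₀ : IsFundSol a b a {a, b} (pathField Γ c₀) onePS W₀)
    (hW₁ : IsFundSol a b a {a, b} (pathField Γ c₁) onePS W₁) :
    seriesAt W₀ b = seriesAt W₁ b := by
  obtain ⟨dΓ, hdΓ, hflat₀, hflat₁⟩ := hflat
  set Q : Set (ℝ × ℝ) := Ioo (a - ε) (b + ε) ×ˢ Ioo (-ε) (1 + ε)
  have hQ : IsOpen Q := isOpen_Ioo.prod isOpen_Ioo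
  have hFQ : ContDiffOn ℝ (⊤ : ℕ∞) F Q := hF.mono h𝒪sub
  have hFat : ∀ x ∈ Q, ContDiffAt ℝ (⊤ : ℕ∞) F x := fun x hx => hFQ.contDiffAt (hQ.mem_nhds hx)
  have hQU : MapsTo F Q U := hFU.mono_left h𝒪sub
  have hsQ : ∀ s ∈ Icc a b, s ∈ Ioo (a - ε) (b + ε) := fun s hs =>
    ⟨by linarith [hs.1], by linarith [hs.2]⟩
  have htQ : ∀ t ∈ Icc (0 : ℝ) 1, t ∈ Ioo (-ε) (1 + ε) := fun t ht =>
    ⟨by linarith [ht.1], by linarith [ht.2]⟩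
  have h0 : (0 : ℝ) ∈ Icc (0 : ℝ) 1 := by simp
  have h1 : (1 : ℝ) ∈ Icc (0 : ℝ) 1 := by simp
  have hFd : ∀ x ∈ Q, HasFDerivAt F (fderiv ℝ F x) x := fun x hx =>
    ((hFat x hx).differentiableAt (by simp)).hasFDerivAt
  refine PowerSeries.ext fun n => ?_
  simp only [seriesAt, PowerSeries.coeff_mk]
  obtain ⟨Φ, -, hΦ0, hΦ⟩ := exists_flat_section hQ ((convex_Ioo _ _).prod (convex_Ioo _ _))
    (hΓ.smoothTensorOn_pullbackField hQ hFQ hQU (1, 0))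
    (hΓ.smoothTensorOn_pullbackField hQ hFQ hQU (0, 1))
    (fun r x hx => hΓ.hasWeakFDerivAt_pullbackField hdΓ hUopen (hFat x hx) (hQU hx) (1, 0) r)
    (fun r x hx => hΓ.hasWeakFDerivAt_pullbackField hdΓ hUopen (hFat x hx) (hQU hx) (0, 1) r)
    (fun x hx => pullbackField_curvature hflat₀ hflat₁ (hFat x hx) (hQU hx) (1, 0) (0, 1))
    (a, 0) n
  -- `Φ` is constant along the two vertical sides, where the homotopy is stationary.
  have hside : ∀ s ∈ Icc a b, ∀ y, (∀ t ∈ Ioo (-ε) (1 + ε), F (s, t) = y) →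
      ∀ k ≤ n, Φ k (s, 1) = Φ k (s, 0) := by
    intro s hs y hy k hk
    rcases k with _ | k
    · rw [hΦ0, hΦ0]
    refine eq_of_forall_dual fun φ => ?_
    have hmap : ∀ t : ℝ, HasDerivAt (fun t : ℝ => (s, t)) ((0 : ℝ), (1 : ℝ)) t := fun t =>
      (hasDerivAt_const t s).prodMk (hasDerivAt_id t)
    have hd : ∀ t ∈ uIcc (0 : ℝ) 1, HasDerivAt (fun t => φ (Φ (k + 1) (s, t))) 0 t := by
      intro t ht
      rw [uIcc_of_le zero_le_one] at ht
      have hx : (s, t) ∈ Q := ⟨hsQ s hs, htQ t ht⟩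
      have hF' : fderiv ℝ F (s, t) (0, 1) = 0 := by
        refine ((hFd _ hx).comp_hasDerivAt t (hmap t)).unique
          ((hasDerivAt_const t y).congr_of_eventuallyEq ?_)
        filter_upwards [isOpen_Ioo.mem_nhds (htQ t ht)] with τ hτ using hy τ hτ
      obtain ⟨L, hL, hLe⟩ := (hΦ k hk).2 _ hx φ
      refine (hL.comp_hasDerivAt t (hmap t)).congr_deriv ?_
      rw [hLe]
      simp [pullbackField, hF']
    have := intervalIntegral.integral_eq_sub_of_hasDerivAt hd (by simp)
    rw [intervalIntegral.integral_zero] at this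
    exact sub_eq_zero.1 this.symm
  have hrow : ∀ t ∈ Icc (0 : ℝ) 1, ∀ c : ℝ → Fin N → ℝ,
      (∀ s ∈ Ioo (a - ε) (b + ε), F (s, t) = c s) → (∀ k ≤ n, Φ k (a, t) = Φ k (a, 0)) →
      ∀ W : ℕ → ℝ → 𝒜, IsFundSol a b a {a, b} (pathField Γ c) onePS W →
      W n b = Φ n (b, t) := by
    intro t ht c hc hleft W hW
    refine hW.eq_of_hasDerivAt (Φ := fun k s => Φ k (s, t)) (fun s _ => hΦ0 _)
      (fun k hk => ?_) (fun k hk s hs φ => ?_) n le_rfl b (right_mem_Icc.2 hab.le)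
    · rw [hleft _ hk, (hΦ k hk).1]
    · have hx : (s, t) ∈ Q := ⟨hsQ s hs, htQ t ht⟩
      have hmap : HasDerivAt (fun s : ℝ => (s, t)) ((1 : ℝ), (0 : ℝ)) s :=
        (hasDerivAt_id s).prodMk (hasDerivAt_const s t)
      have hc' : HasDerivAt c (fderiv ℝ F (s, t) (1, 0)) s := by
        refine ((hFd _ hx).comp_hasDerivAt s hmap).congr_of_eventuallyEq ?_
        filter_upwards [isOpen_Ioo.mem_nhds (hsQ s hs)] with σ hσ using (hc σ hσ).symm
      have hfield : ∀ u, pathField Γ c u s = pullbackField Γ F (1, 0) u (s, t) := fun u => by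
        simp only [pathField, pullbackField, (hasDerivAt_pi.1 hc' _).deriv, hc s (hsQ s hs)]
      obtain ⟨L, hL, hLe⟩ := (hΦ k hk).2 _ hx φ
      refine (hL.comp_hasDerivAt s hmap).congr_deriv ?_
      rw [hLe]
      simp [hfield]
  rw [hrow 0 h0 c₀ (fun s hs => (hF0 s hs).1) (fun _ _ => rfl) W₀ hW₀,
    hrow 1 h1 c₁ (fun s hs => (hF0 s hs).2)
      (hside a (left_mem_Icc.2 hab.le) p fun t ht => (hFa t ht).1) W₁ hW₁,
    hside b (right_mem_Icc.2 hab.le) q (fun t ht => (hFa t ht).2) n le_rfl]
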